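/- arXiv:1912.01644 — 2 statements merged into one kernel-verified Lean document; each statement's English description precedes it below -/
import Mathlib

section
/- Let n ≥ 4 and h ≥ 1 be integers, let m be an integer with m ≥ ⌊-2n/3⌋ + 1 (floor of the rational -2n/3), and let x be a real number with x ≥ 3m/(2nh). Set b₁ = √(n²/4 + 2x) - n/2 and b₂ = -√(n²/4 + 2x) - n/2 (real square root). Then b₁ > -1/(2h) and b₂ + n < 1/(2h). -/
theorem stmt_9 (n h m : ℤ) (x : ℝ) (hn : n ≥ 4) (hh : h ≥ 1)
    (hm : m ≥ ⌊(-2 * n : ℚ) / 3⌋ + 1)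
    (hx : x ≥ 3 * (m : ℝ) / (2 * n * h))
    (b₁ b₂ : ℝ)
    (hb₁ : b₁ = Real.sqrt ((n : ℝ) ^ 2 / 4 + 2 * x) - (n : ℝ) / 2)
    (hb₂ : b₂ = -Real.sqrt ((n : ℝ) ^ 2 / 4 + 2 * x) - (n : ℝ) / 2) :
    b₁ > -1 / (2 * h) ∧ b₂ + n < 1 / (2 * h) := by
  have h3m : -2 * n < 3 * m := by
    have hlt := (Int.floor_lt (z := m)).mp (Int.lt_of_add_one_le hm)
    have hlt' : (-2 * n : ℚ) < 3 * m := by linarith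
    exact_mod_cast hlt'
  have hmn : n - 2 * n ^ 2 < 12 * m := by
    rcases hn.lt_or_eq with h5 | h4
    · nlinarith
    · subst h4
      omega
  have hn' : (4 : ℝ) ≤ n := by exact_mod_cast hn
  have hh' : (1 : ℝ) ≤ h := by exact_mod_cast hh
  have hmn' : (n : ℝ) - 2 * n ^ 2 < 12 * m := by exact_mod_cast hmn
  have hn0 : (0 : ℝ) < n := by linarith
  have hh0 : (0 : ℝ) < h := by linarith
  obtain ⟨t, ht⟩ : ∃ t : ℝ, t = 1 / (2 * h) := ⟨_, rfl⟩
  have ht0 : 0 < t := by rw [ht]; positivity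
  have ht1 : t ≤ 1 / 2 := by
    rw [ht, div_le_div_iff₀ (by positivity) (by norm_num)]
    linarith
  have hslope : 1 / 4 - (n : ℝ) / 2 < 3 * m / n := by
    rw [lt_div_iff₀ hn0]
    nlinarith
  have hx' : 3 * (m : ℝ) / n * t ≤ x := by
    refine le_of_eq_of_le ?_ hx
    rw [ht]
    field_simp
  have hsqrt : (n : ℝ) / 2 - t < Real.sqrt ((n : ℝ) ^ 2 / 4 + 2 * x) := by
    apply Real.lt_sqrt_of_sq_lt
    nlinarith [mul_lt_mul_of_pos_right hslope ht0, mul_le_mul_of_nonneg_right ht1 ht0.le]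
  have hneg : -1 / (2 * (h : ℝ)) = -t := by rw [ht, neg_div]
  rw [hneg, ← ht, hb₁, hb₂]
  constructor <;> linarith
end

section
/- Let n, h, m, x be real numbers with n ≥ 10, h ≥ 1, m ≥ -2n + 5 and x ≥ 3m/(2nh). Set b₁ = √(n²/4 + 2x) - n/2 and b₂ = -√(n²/4 + 2x) - n/2 (real square root). Then b₁ > -1/(2h) and b₂ + n < 1/(2h). -/
theorem stmt_10 (n h m x : ℝ) (hn : n ≥ 10) (hh : h ≥ 1) (hm : m ≥ -2 * n + 5)
    (hx : x ≥ 3 * m / (2 * n * h))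
    (b₁ b₂ : ℝ)
    (hb₁ : b₁ = Real.sqrt (n ^ 2 / 4 + 2 * x) - n / 2)
    (hb₂ : b₂ = -Real.sqrt (n ^ 2 / 4 + 2 * x) - n / 2) :
    b₁ > -1 / (2 * h) ∧ b₂ + n < 1 / (2 * h) := by
  have hn0 : 0 < n := by linarith
  have hh0 : 0 < h := by linarith
  have hx' : 3 * m ≤ x * (2 * n * h) := (div_le_iff₀ (by positivity)).mp hx
  have key : n / 2 - 1 / (2 * h) < Real.sqrt (n ^ 2 / 4 + 2 * x) := by
    apply Real.lt_sqrt_of_sq_lt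
    have hquad : n < 2 * n ^ 2 - 24 * n + 60 := by nlinarith
    have hlin : n < h * (2 * n ^ 2 - 24 * n + 60) := by nlinarith
    have hscaled : h * (3 * (-2 * n + 5)) ≤ h * (x * (2 * n * h)) :=
      mul_le_mul_of_nonneg_left (by linarith) hh0.le
    have hpos : 0 < (8 * x * h ^ 2 * n + 2 * n ^ 2 * h - n) / (4 * h ^ 2 * n) :=
      div_pos (by nlinarith) (by positivity)
    have hdiff : n ^ 2 / 4 + 2 * x - (n / 2 - 1 / (2 * h)) ^ 2 =
        (8 * x * h ^ 2 * n + 2 * n ^ 2 * h - n) / (4 * h ^ 2 * n) := by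
      field_simp
      ring
    linarith
  have hneg : -1 / (2 * h) = -(1 / (2 * h)) := neg_div _ _
  constructor <;> linarith
end
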